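/- The maximal correlation ribbon 𝔖(X_1, …, X_k) equals the full cube [0,1]^k if and only if the random variables X_1, …, X_k are pairwise independent. -/

import Mathlib

open Finset

noncomputable section

/-- A probability mass function on a finite type. -/
def IsPMF {Ω : Type*} [Fintype Ω] (p : Ω → ℝ) : Prop :=
  (∀ ω, 0 ≤ p ω) ∧ ∑ ω, p ω = 1

/-- Expectation of `f` under the pmf `p`. -/
def expect {Ω : Type*} [Fintype Ω] (p : Ω → ℝ) (f : Ω → ℝ) : ℝ :=
  ∑ ω, p ω * f ω

/-- Variance of `f` under the pmf `p`. -/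
def var {Ω : Type*} [Fintype Ω] (p : Ω → ℝ) (f : Ω → ℝ) : ℝ :=
  ∑ ω, p ω * (f ω - expect p f) ^ 2

open scoped Classical in
/-- Conditional expectation `E[f | X]`, as a function on the sample space. -/
def condExp {Ω β : Type*} [Fintype Ω] (p : Ω → ℝ) (f : Ω → ℝ) (X : Ω → β) : Ω → ℝ :=
  fun ω => (∑ ω', if X ω' = X ω then p ω' * f ω' else 0) /
    (∑ ω', if X ω' = X ω then p ω' else 0)

/-- The Φ-entropy `H_Φ(f) = E[Φ(f)] - Φ(E[f])`. -/
def Hphi {Ω : Type*} [Fintype Ω] (Φ : ℝ → ℝ) (p : Ω → ℝ) (f : Ω → ℝ) : ℝ :=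
  expect p (fun ω => Φ (f ω)) - Φ (expect p f)

/-- The conditional Φ-entropy `H_Φ(f | X) = E[Φ(f)] - E[Φ(E[f|X])]`. -/
def HphiCond {Ω β : Type*} [Fintype Ω] (Φ : ℝ → ℝ) (p : Ω → ℝ) (f : Ω → ℝ) (X : Ω → β) : ℝ :=
  expect p (fun ω => Φ (f ω)) - expect p (fun ω => Φ (condExp p f X ω))

/-- The class 𝓕 of smooth convex non-affine functions `Φ` on a convex domain `D ⊆ ℝ`
such that for every `q ∈ [0,1]` the map
`(s,t) ↦ q Φ(s) + (1-q) Φ(t) - Φ(q s + (1-q) t)` is jointly convex. -/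
structure ClassF where
  D : Set ℝ
  Φ : ℝ → ℝ
  convex_dom : Convex ℝ D
  smooth : ContDiffOn ℝ (⊤ : ℕ∞) Φ D
  convexOn : ConvexOn ℝ D Φ
  not_affine : ¬ ∃ a b : ℝ, ∀ t ∈ D, Φ t = a * t + b
  joint_convex : ∀ q ∈ Set.Icc (0:ℝ) 1,
    ConvexOn ℝ (D ×ˢ D)
      (fun st : ℝ × ℝ => q * Φ st.1 + (1 - q) * Φ st.2 - Φ (q * st.1 + (1 - q) * st.2))

/-- The maximal correlation ribbon `𝔖(X_1, …, X_k)` of a joint pmf `p`: all tuples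
`λ ∈ [0,1]^k` such that `Var[f] ≥ Σ_i λ_i Var[E[f | X_i]]` for every real-valued `f`. -/
def mcRibbon {k : ℕ} {α : Fin k → Type} [∀ i, Fintype (α i)]
    (p : (∀ i, α i) → ℝ) : Set (Fin k → ℝ) :=
  {l | (∀ i, l i ∈ Set.Icc (0:ℝ) 1) ∧ ∀ f : (∀ i, α i) → ℝ,
    var p f ≥ ∑ i, l i * var p (condExp p f (fun ω => ω i))}

section Covariance

variable {Ω : Type*} [Fintype Ω]

/-- Covariance of `f` and `g` under the pmf `p`. -/
def covar (p f g : Ω → ℝ) : ℝ :=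
  _root_.expect p (fun ω => f ω * g ω) - _root_.expect p f * _root_.expect p g

lemma covar_comm (p f g : Ω → ℝ) : covar p f g = covar p g f := by
  simp only [covar, mul_comm]

lemma covar_add_left (p f g h : Ω → ℝ) :
    covar p (fun ω => f ω + g ω) h = covar p f h + covar p g h := by
  simp only [covar, _root_.expect, add_mul, mul_add, sum_add_distrib]
  ring

lemma covar_smul_left (p f h : Ω → ℝ) (c : ℝ) :
    covar p (fun ω => c * f ω) h = c * covar p f h := by
  simp only [covar, _root_.expect, mul_sub, mul_sum, sum_mul]
  congr 1
  · exact sum_congr rfl fun _ _ => by ring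
  · exact sum_congr rfl fun _ _ => sum_congr rfl fun _ _ => by ring

lemma covar_sum_left {ι : Type*} (s : Finset ι) (p : Ω → ℝ) (f : ι → Ω → ℝ) (h : Ω → ℝ) :
    covar p (fun ω => ∑ i ∈ s, f i ω) h = ∑ i ∈ s, covar p (f i) h := by
  classical
  induction s using Finset.induction_on with
  | empty => simp [covar, _root_.expect]
  | insert a s ha ih => simp only [sum_insert ha, covar_add_left, ih]

lemma var_eq_covar {p : Ω → ℝ} (hp : IsPMF p) (f : Ω → ℝ) : var p f = covar p f f := by
  have h (m : ℝ) : ∑ ω, p ω * (f ω - m) ^ 2 =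
      _root_.expect p (fun ω => f ω * f ω) - 2 * m * _root_.expect p f + m ^ 2 * ∑ ω, p ω := by
    simp only [_root_.expect, mul_sum, ← sum_sub_distrib, ← sum_add_distrib]
    exact sum_congr rfl fun _ _ => by ring
  rw [var, h, hp.2, covar]
  ring

lemma var_nonneg {p : Ω → ℝ} (hp : IsPMF p) (f : Ω → ℝ) : 0 ≤ var p f :=
  sum_nonneg fun ω _ => mul_nonneg (hp.1 ω) (sq_nonneg _)

lemma var_add_smul {p : Ω → ℝ} (hp : IsPMF p) (f g : Ω → ℝ) (c : ℝ) :
    var p (fun ω => f ω + c * g ω) = var p f + 2 * c * covar p f g + c ^ 2 * var p g := by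
  simp only [var_eq_covar hp, covar_add_left, covar_smul_left]
  rw [covar_comm p f, covar_comm p g (fun ω => f ω + c * g ω)]
  simp only [covar_add_left, covar_smul_left]
  rw [covar_comm p g f]
  ring

/-- `E[f | X]` as a function on the range of `X`. -/
lemma exists_condExp_eq_comp {β : Type*} (p f : Ω → ℝ) (X : Ω → β) :
    ∃ u : β → ℝ, condExp p f X = fun ω => u (X ω) := by
  classical
  exact ⟨fun x => (∑ ω', if X ω' = x then p ω' * f ω' else 0) /
    (∑ ω', if X ω' = x then p ω' else 0), rfl⟩

variable {β γ : Type*} [Fintype β] [Fintype γ]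

open scoped Classical in
lemma expect_comp_mul (p f : Ω → ℝ) (X : Ω → β) (u : β → ℝ) :
    _root_.expect p (fun ω => f ω * u (X ω)) =
      ∑ x, (∑ ω, if X ω = x then p ω * f ω else 0) * u x := by
  simp only [_root_.expect, sum_mul, ite_mul, zero_mul]
  rw [sum_comm]
  simp [mul_assoc]

open scoped Classical in
lemma expect_comp (p : Ω → ℝ) (X : Ω → β) (u : β → ℝ) :
    _root_.expect p (fun ω => u (X ω)) = ∑ x, (∑ ω, if X ω = x then p ω else 0) * u x := by
  simpa using expect_comp_mul p (fun _ => 1) X u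

lemma expect_condExp_mul {p : Ω → ℝ} (hp : IsPMF p) (f : Ω → ℝ) (X : Ω → β) (u : β → ℝ) :
    _root_.expect p (fun ω => condExp p f X ω * u (X ω)) =
      _root_.expect p (fun ω => f ω * u (X ω)) := by
  classical
  rw [expect_comp_mul p f]
  have h := expect_comp p X (fun x => (∑ ω', if X ω' = x then p ω' * f ω' else 0) /
    (∑ ω', if X ω' = x then p ω' else 0) * u x)
  refine h.trans (sum_congr rfl fun x _ => ?_)
  rw [← mul_assoc]
  congr 1
  by_cases hD : (∑ ω, if X ω = x then p ω else 0) = 0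
  · rw [hD, zero_mul]
    rw [sum_eq_zero_iff_of_nonneg fun ω _ => by split_ifs <;> simp [hp.1]] at hD
    refine (sum_eq_zero fun ω hω => ?_).symm
    have := hD ω hω
    split_ifs at this ⊢ <;> simp_all
  · exact mul_div_cancel₀ _ hD

lemma covar_condExp {p : Ω → ℝ} (hp : IsPMF p) (f : Ω → ℝ) (X : Ω → β) (u : β → ℝ) :
    covar p (condExp p f X) (fun ω => u (X ω)) = covar p f (fun ω => u (X ω)) := by
  have h := expect_condExp_mul hp f X (fun _ => 1)
  simp only [mul_one] at h
  unfold covar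
  rw [expect_condExp_mul hp, ← h]

lemma covar_self_condExp {p : Ω → ℝ} (hp : IsPMF p) (f : Ω → ℝ) (X : Ω → β) :
    covar p f (condExp p f X) = var p (condExp p f X) := by
  obtain ⟨u, hu⟩ := exists_condExp_eq_comp p f X
  rw [var_eq_covar hp]
  nth_rw 3 [hu]
  rw [covar_condExp hp, ← hu]

lemma two_mul_covar_sub_var_le_var_condExp {p : Ω → ℝ} (hp : IsPMF p) (f : Ω → ℝ)
    (X : Ω → β) (u : β → ℝ) :
    2 * covar p f (fun ω => u (X ω)) - var p (fun ω => u (X ω)) ≤ var p (condExp p f X) := by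
  have h := var_nonneg hp (fun ω => condExp p f X ω + (-1) * u (X ω))
  rw [var_add_smul hp, covar_condExp hp] at h
  linarith

open scoped Classical in
lemma covar_eq_zero_of_indep (p : Ω → ℝ) (X : Ω → β) (Y : Ω → γ)
    (h : ∀ x y, (∑ ω, if X ω = x ∧ Y ω = y then p ω else 0)
      = (∑ ω, if X ω = x then p ω else 0) * (∑ ω, if Y ω = y then p ω else 0))
    (u : β → ℝ) (v : γ → ℝ) :
    covar p (fun ω => u (X ω)) (fun ω => v (Y ω)) = 0 := by
  rw [covar, expect_comp, expect_comp,
    expect_comp p (fun ω => (X ω, Y ω)) (fun z => u z.1 * v z.2), sub_eq_zero,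
    Fintype.sum_prod_type, sum_mul_sum]
  refine sum_congr rfl fun x _ => sum_congr rfl fun y _ => ?_
  simp only [Prod.mk.injEq, h]
  ring

end Covariance

/-- If every variance is at least the sum of the variances of the conditional expectations on
`X` and `Y`, then functions of `X` and of `Y` are nonpositively correlated. -/
lemma covar_nonpos_of_var_condExp_add_le {Ω β γ : Type*} [Fintype Ω] [Fintype β] [Fintype γ]
    {p : Ω → ℝ} (hp : IsPMF p) (X : Ω → β) (Y : Ω → γ)
    (h : ∀ f, var p (condExp p f X) + var p (condExp p f Y) ≤ var p f)
    (u : β → ℝ) (v : γ → ℝ) :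
    covar p (fun ω => u (X ω)) (fun ω => v (Y ω)) ≤ 0 := by
  have hf := h (fun ω => u (X ω) + v (Y ω))
  have hX := two_mul_covar_sub_var_le_var_condExp hp (fun ω => u (X ω) + v (Y ω)) X u
  have hY := two_mul_covar_sub_var_le_var_condExp hp (fun ω => u (X ω) + v (Y ω)) Y v
  have hv := var_add_smul hp (fun ω => u (X ω)) (fun ω => v (Y ω)) 1
  simp only [one_mul] at hv
  rw [covar_add_left, ← var_eq_covar hp] at hX hY
  rw [covar_comm p (fun ω => v (Y ω))] at hX
  linarith

lemma sum_var_condExp_le_var {Ω ι : Type*} [Fintype Ω] [Fintype ι] {β : ι → Type*}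
    [∀ i, Fintype (β i)] {p : Ω → ℝ} (hp : IsPMF p) (X : ∀ i, Ω → β i)
    (h : ∀ i j, i ≠ j → ∀ (u : β i → ℝ) (v : β j → ℝ),
      covar p (fun ω => u (X i ω)) (fun ω => v (X j ω)) = 0) (f : Ω → ℝ) :
    ∑ i, var p (condExp p f (X i)) ≤ var p f := by
  have hcov : ∀ i j, i ≠ j → covar p (condExp p f (X i)) (condExp p f (X j)) = 0 := by
    intro i j hij
    obtain ⟨u, hu⟩ := exists_condExp_eq_comp p f (X i)
    obtain ⟨v, hv⟩ := exists_condExp_eq_comp p f (X j)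
    rw [hu, hv]
    exact h i j hij u v
  have hS : var p (fun ω => ∑ i, condExp p f (X i) ω) = ∑ i, var p (condExp p f (X i)) := by
    rw [var_eq_covar hp, covar_sum_left]
    refine sum_congr rfl fun i _ => ?_
    rw [covar_comm, covar_sum_left, var_eq_covar hp]
    exact Fintype.sum_eq_single i fun j hj => hcov j i hj
  have hfS : covar p f (fun ω => ∑ i, condExp p f (X i) ω)
      = ∑ i, var p (condExp p f (X i)) := by
    rw [covar_comm, covar_sum_left]
    exact sum_congr rfl fun i _ => by rw [covar_comm, covar_self_condExp hp]
  have h0 := var_nonneg hp (fun ω => f ω + (-1) * ∑ i, condExp p f (X i) ω)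
  rw [var_add_smul hp, hS, hfS] at h0
  linarith

open scoped Classical in
/-- The MC ribbon `𝔖(X_1, …, X_k)` equals the full cube `[0,1]^k` iff
`X_1, …, X_k` are pairwise independent. -/
theorem mcRibbon_full_iff_pairwise_indep
    {k : ℕ} {α : Fin k → Type} [∀ i, Fintype (α i)]
    (p : (∀ i, α i) → ℝ) (hp : IsPMF p) :
    mcRibbon p = {l : Fin k → ℝ | ∀ i, l i ∈ Set.Icc (0:ℝ) 1} ↔
      ∀ i j, i ≠ j → ∀ (x : α i) (y : α j),
        (∑ ω, if ω i = x ∧ ω j = y then p ω else 0)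
          = (∑ ω, if ω i = x then p ω else 0) * (∑ ω, if ω j = y then p ω else 0) := by
  constructor
  · intro hfull i j hij x y
    have hle : ∀ f, var p (condExp p f fun ω => ω i) + var p (condExp p f fun ω => ω j)
        ≤ var p f := by
      intro f
      have hmem : (fun _ => 1 : Fin k → ℝ) ∈ mcRibbon p := by simp [hfull]
      have hf := hmem.2 f
      simp only [one_mul] at hf
      rw [← sum_pair (f := fun m => var p (condExp p f fun ω => ω m)) hij]
      exact (sum_le_univ_sum_of_nonneg fun m => var_nonneg hp _).trans hf
    have hneg := covar_nonpos_of_var_condExp_add_le hp _ _ hle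
    have h₁ := hneg (fun z => if z = x then 1 else 0) (fun z => if z = y then 1 else 0)
    have h₂ := hneg (fun z => -1 * if z = x then 1 else 0) (fun z => if z = y then 1 else 0)
    rw [covar_smul_left] at h₂
    have h₀ : covar p (fun ω => if ω i = x then 1 else 0) (fun ω => if ω j = y then 1 else 0)
        = 0 := by linarith
    rw [covar, sub_eq_zero] at h₀
    simpa [_root_.expect, ← ite_and, and_comm] using h₀
  · intro hind
    refine Set.Subset.antisymm (fun l hl => hl.1) fun l hl => ⟨hl, fun f => ?_⟩
    refine le_trans (sum_le_sum fun i _ => mul_le_of_le_one_left (var_nonneg hp _) (hl i).2) ?_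
    exact sum_var_condExp_le_var hp (fun i ω => ω i)
      (fun i j hij => covar_eq_zero_of_indep p _ _ (hind i j hij)) f

end
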